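/- arXiv:1712.05871 — 3 statements merged into one kernel-verified Lean document; each statement's English description precedes it below -/
import Mathlib

section
/- Explicit transforms for data on the coordinate axes: In ℝ², let K = {(x, 0) : x ∈ ℝ} ∪ {(0, y) : y ∈ ℝ} and define f : K → ℝ by f(x, 0) = |x| and f(0, y) = −|y| (so f(0,0) = 0). Then for every λ > 0 and every (x, y) ∈ ℝ² (note co[K] = ℝ²): C^l_λ(f_K^{+∞})(x,y) = 2|x| − 1/(4λ) − λ(x² + y²) if |x| + |y| ≤ 1/(2λ), and C^l_λ(f_K^{+∞})(x,y) = |x| + 2λ|x||y| − |y| if |x| + |y| ≥ 1/(2λ); C^u_λ(f_K^{−∞})(x,y) = −2|y| + 1/(4λ) + λ(x² + y²) if |x| + |y| ≤ 1/(2λ), and C^u_λ(f_K^{−∞})(x,y) = |x| − 2λ|x||y| − |y| if |x| + |y| ≥ 1/(2λ); consequently A^∞_λ(f_K)(x, y) = |x| − |y| for all (x, y) ∈ ℝ². -/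
open Metric Set

variable {E : Type*}

/-- `Einf lam f K x`: value at `x` of the convex envelope of the function equal to
`f + lam‖·‖²` on `K` and `+∞` off `K`, expressed as an infimum over finite convex
combinations of points of `K`. -/
noncomputable def Einf [NormedAddCommGroup E] [NormedSpace ℝ E]
    (lam : ℝ) (f : E → ℝ) (K : Set E) (x : E) : ℝ :=
  sInf {v : ℝ | ∃ (k : ℕ) (μ : Fin k → ℝ) (p : Fin k → E),
    (∀ i, 0 ≤ μ i) ∧ (∀ i, p i ∈ K) ∧ (∑ i, μ i) = 1 ∧ (∑ i, μ i • p i) = x ∧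
    v = ∑ i, μ i * (f (p i) + lam * ‖p i‖ ^ 2)}

/-- Lower compensated convex transform `C^l_λ(f_K^{+∞})`. -/
noncomputable def lowerInf [NormedAddCommGroup E] [NormedSpace ℝ E]
    (lam : ℝ) (f : E → ℝ) (K : Set E) (x : E) : ℝ :=
  Einf lam f K x - lam * ‖x‖ ^ 2

/-- Upper compensated convex transform `C^u_λ(f_K^{−∞})`. -/
noncomputable def upperInf [NormedAddCommGroup E] [NormedSpace ℝ E]
    (lam : ℝ) (f : E → ℝ) (K : Set E) (x : E) : ℝ :=
  lam * ‖x‖ ^ 2 - Einf lam (fun y => -f y) K x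

/-- Average approximation `A^∞_λ(f_K)`. -/
noncomputable def avgInf [NormedAddCommGroup E] [NormedSpace ℝ E]
    (lam : ℝ) (f : E → ℝ) (K : Set E) (x : E) : ℝ :=
  (lowerInf lam f K x + upperInf lam f K x) / 2

/-- A value of an affine minorant of `f + lam‖·‖²` on `K` that is attained by a convex combination
of points of `K` is the value of the convex envelope. -/
theorem Einf_eq_of_affine_minorant [NormedAddCommGroup E] [NormedSpace ℝ E]
    {lam : ℝ} {f : E → ℝ} {K : Set E} {x : E} (L : E →L[ℝ] ℝ) (c : ℝ)
    (hL : ∀ q ∈ K, L q + c ≤ f q + lam * ‖q‖ ^ 2)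
    {k : ℕ} (μ : Fin k → ℝ) (q : Fin k → E) (hμ : ∀ i, 0 ≤ μ i) (hq : ∀ i, q i ∈ K)
    (hsum : ∑ i, μ i = 1) (hx : ∑ i, μ i • q i = x)
    (hv : ∑ i, μ i * (f (q i) + lam * ‖q i‖ ^ 2) = L x + c) :
    Einf lam f K x = L x + c := by
  refine IsLeast.csInf_eq ⟨⟨k, μ, q, hμ, hq, hsum, hx, hv.symm⟩, ?_⟩
  rintro v ⟨m, ν, y, hν, hy, hνsum, rfl, rfl⟩
  calc L (∑ i, ν i • y i) + c = ∑ i, ν i * (L (y i) + c) := by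
        simp [mul_add, Finset.sum_add_distrib, ← Finset.sum_mul, hνsum]
    _ ≤ ∑ i, ν i * (f (y i) + lam * ‖y i‖ ^ 2) :=
        Finset.sum_le_sum fun i _ => mul_le_mul_of_nonneg_left (hL _ (hy i)) (hν i)

theorem exists_sign_mul_eq_abs (x : ℝ) : ∃ s : ℝ, s * s = 1 ∧ |s| = 1 ∧ s * x = |x| := by
  rcases le_total 0 x with h | h
  · exact ⟨1, by simp [abs_of_nonneg h]⟩
  · exact ⟨-1, by simp [abs_of_nonpos h]⟩

theorem sign_mul_le_abs {s : ℝ} (hs : |s| = 1) (z : ℝ) : s * z ≤ |z| := by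
  simpa [abs_mul, hs] using le_abs_self (s * z)

theorem norm_sq_eq_of_ne {i j : Fin 2} (hij : i ≠ j) (p : EuclideanSpace ℝ (Fin 2)) :
    ‖p‖ ^ 2 = p i ^ 2 + p j ^ 2 := by
  rw [EuclideanSpace.real_norm_sq_eq, Fin.sum_univ_two]
  fin_cases i <;> fin_cases j <;> simp_all [add_comm]

theorem ext_of_ne {i j : Fin 2} (hij : i ≠ j) {p q : EuclideanSpace ℝ (Fin 2)}
    (hi : p i = q i) (hj : p j = q j) : p = q := by
  ext k
  obtain rfl | rfl : k = i ∨ k = j := by omega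
  exacts [hi, hj]

/-- The convex envelope for axis data `|p i|` and `-|p j|`, inside the square
`|p i| + |p j| ≤ 1 / (2 * lam)`. -/
theorem Einf_axes_of_le
    {i j : Fin 2} (hij : i ≠ j) {K : Set (EuclideanSpace ℝ (Fin 2))}
    (hK : ∀ p, p ∈ K ↔ p j = 0 ∨ p i = 0) {f : EuclideanSpace ℝ (Fin 2) → ℝ}
    (hfi : ∀ p : EuclideanSpace ℝ (Fin 2), p j = 0 → f p = |p i|)
    (hfj : ∀ p : EuclideanSpace ℝ (Fin 2), p i = 0 → f p = -|p j|)
    {lam : ℝ} (hlam : 0 < lam) (p : EuclideanSpace ℝ (Fin 2))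
    (h : |p i| + |p j| ≤ 1 / (2 * lam)) :
    Einf lam f K p = 2 * |p i| - 1 / (4 * lam) := by
  obtain ⟨s, hss, hs, hsp⟩ := exists_sign_mul_eq_abs (p i)
  obtain ⟨r, hr⟩ : ∃ r, r = 1 / (2 * lam) := ⟨_, rfl⟩
  have hr0 : 0 < r := by rw [hr]; positivity
  have hlr : 2 * lam * r = 1 := by rw [hr]; field_simp
  have hr2 : 1 / (4 * lam) = r / 2 := by rw [hr]; field_simp; norm_num
  have hji : j ≠ i := hij.symm
  rw [← hr] at h
  have habs : |p i| = s * p i := hsp.symm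
  have hpj := le_abs_self (p j)
  have hpj' := neg_abs_le (p j)
  have hrow : 2 * |p i| - 1 / (4 * lam) =
      ((2 * s) • EuclideanSpace.proj (𝕜 := ℝ) i : EuclideanSpace ℝ (Fin 2) →L[ℝ] ℝ) p
        + -(r / 2) := by
    simp [hr2, habs]; ring
  rw [hrow]
  refine Einf_eq_of_affine_minorant _ _ ?_
    ![2 * lam * |p i|, (1 - 2 * lam * |p i| + 2 * lam * p j) / 2,
      (1 - 2 * lam * |p i| - 2 * lam * p j) / 2]
    ![EuclideanSpace.single i (s * r), EuclideanSpace.single j r, EuclideanSpace.single j (-r)]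
    ?_ ?_ ?_ ?_ ?_
  · intro q hq
    have hsq := sign_mul_le_abs hs (q i)
    rw [norm_sq_eq_of_ne hij]
    rcases (hK q).1 hq with h0 | h0
    · rw [hfi q h0, h0]
      simp
      nlinarith [mul_nonneg hlam.le (sq_nonneg (|q i| - r)), sq_abs (q i)]
    · rw [hfj q h0, h0]
      simp [h0]
      nlinarith [mul_nonneg hlam.le (sq_nonneg (|q j| - r)), sq_abs (q j)]
  · have h1 : 2 * lam * (r - |p i| - p j) ≥ 0 := by
      apply mul_nonneg <;> linarith
    have h2 : 2 * lam * (r - |p i| + p j) ≥ 0 := by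
      apply mul_nonneg <;> linarith
    intro k
    fin_cases k
    · simp; positivity
    · simp; linarith
    · simp; linarith
  · intro k
    rw [hK]
    fin_cases k <;> simp [hij, hji]
  · simp [Fin.sum_univ_three]; ring
  · apply ext_of_ne hij
    · simp [Fin.sum_univ_three, hij, habs]
      linear_combination p i * s * s * hlr + p i * hss
    · simp [Fin.sum_univ_three, hji]
      linear_combination p j * hlr
  · have e0 := hfi (EuclideanSpace.single i (s * r)) (by simp [hji])
    have e1 := hfj (EuclideanSpace.single j r) (by simp [hij])
    have e2 := hfj (EuclideanSpace.single j (-r)) (by simp [hij])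
    simp [Fin.sum_univ_three, e0, e1, e2, abs_mul, hs, abs_of_pos hr0, habs]
    linear_combination (2 * s * p i + r / 2) * hlr

/-- The convex envelope for axis data `|p i|` and `-|p j|`, outside the square
`|p i| + |p j| ≤ 1 / (2 * lam)`. -/
theorem Einf_axes_of_ge
    {i j : Fin 2} (hij : i ≠ j) {K : Set (EuclideanSpace ℝ (Fin 2))}
    (hK : ∀ p, p ∈ K ↔ p j = 0 ∨ p i = 0) {f : EuclideanSpace ℝ (Fin 2) → ℝ}
    (hfi : ∀ p : EuclideanSpace ℝ (Fin 2), p j = 0 → f p = |p i|)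
    (hfj : ∀ p : EuclideanSpace ℝ (Fin 2), p i = 0 → f p = -|p j|)
    {lam : ℝ} (hlam : 0 < lam) (p : EuclideanSpace ℝ (Fin 2))
    (h : 1 / (2 * lam) ≤ |p i| + |p j|) :
    Einf lam f K p = |p i| - |p j| + lam * (|p i| + |p j|) ^ 2 := by
  obtain ⟨s, hss, hs, hsp⟩ := exists_sign_mul_eq_abs (p i)
  obtain ⟨t, htt, ht, htp⟩ := exists_sign_mul_eq_abs (p j)
  obtain ⟨r, hr⟩ : ∃ r, r = |p i| + |p j| := ⟨_, rfl⟩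
  have hr0 : 0 < r := by rw [hr]; exact lt_of_lt_of_le (by positivity) h
  have hlr : 1 ≤ 2 * lam * r := by
    rw [← hr, div_le_iff₀ (by positivity)] at h; linarith
  have hji : j ≠ i := hij.symm
  have hrow : |p i| - |p j| + lam * (|p i| + |p j|) ^ 2 =
      ((s * (2 * lam * r + 1)) • EuclideanSpace.proj (𝕜 := ℝ) i
        + (t * (2 * lam * r - 1)) • EuclideanSpace.proj (𝕜 := ℝ) j :
          EuclideanSpace ℝ (Fin 2) →L[ℝ] ℝ) p + -(lam * r ^ 2) := by
    simp [← hsp, ← htp] at hr ⊢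
    rw [← hr]
    linear_combination (2 * lam * r) * hr
  rw [hrow]
  refine Einf_eq_of_affine_minorant _ _ ?_ ![|p i| / r, |p j| / r]
    ![EuclideanSpace.single i (s * r), EuclideanSpace.single j (t * r)] ?_ ?_ ?_ ?_ ?_
  · intro q hq
    rw [norm_sq_eq_of_ne hij]
    rcases (hK q).1 hq with h0 | h0
    · have hsq := mul_le_mul_of_nonneg_right (sign_mul_le_abs hs (q i))
        (by linarith : 0 ≤ 2 * lam * r + 1)
      rw [hfi q h0, h0]
      simp [h0]
      nlinarith [mul_nonneg hlam.le (sq_nonneg (|q i| - r)), sq_abs (q i)]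
    · have hsq := mul_le_mul_of_nonneg_right (sign_mul_le_abs ht (q j))
        (by linarith : 0 ≤ 2 * lam * r - 1)
      rw [hfj q h0, h0]
      simp [h0]
      nlinarith [mul_nonneg hlam.le (sq_nonneg (|q j| - r)), sq_abs (q j)]
  · intro k
    fin_cases k <;> simp <;> positivity
  · intro k
    rw [hK]
    fin_cases k <;> simp [hij, hji]
  · simp [Fin.sum_univ_two, ← add_div, ← hr, hr0.ne']
  · apply ext_of_ne hij
    · simp [Fin.sum_univ_two, hij, ← hsp]
      field_simp
      linear_combination p i * hss
    · simp [Fin.sum_univ_two, hji, ← htp]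
      field_simp
      linear_combination p j * htt
  · have e0 := hfi (EuclideanSpace.single i (s * r)) (by simp [hji])
    have e1 := hfj (EuclideanSpace.single j (t * r)) (by simp [hij])
    rw [← hrow, ← hr]
    simp [Fin.sum_univ_two, e0, e1, abs_mul, hs, ht, abs_of_pos hr0]
    field_simp
    rw [hr]
    ring

/-- **Explicit transforms for data on the coordinate axes.** In `ℝ²`, with `K` the union of the
coordinate axes and `f(x,0) = |x|`, `f(0,y) = −|y|`, the lower and upper transforms
`C^l_λ(f_K^{+∞})`, `C^u_λ(f_K^{−∞})` are given by explicit piecewise formulas and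
`A^∞_λ(f_K)(x,y) = |x| − |y|` for every `λ > 0` and every `(x,y) ∈ ℝ² = co[K]`. -/
theorem transforms_coordinate_axes
    (K : Set (EuclideanSpace ℝ (Fin 2)))
    (hK : K = {p : EuclideanSpace ℝ (Fin 2) | p 1 = 0} ∪
      {p : EuclideanSpace ℝ (Fin 2) | p 0 = 0})
    (f : EuclideanSpace ℝ (Fin 2) → ℝ)
    (hf1 : ∀ p : EuclideanSpace ℝ (Fin 2), p 1 = 0 → f p = |p 0|)
    (hf2 : ∀ p : EuclideanSpace ℝ (Fin 2), p 0 = 0 → f p = -|p 1|)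
    (lam : ℝ) (hlam : 0 < lam) :
    ∀ p : EuclideanSpace ℝ (Fin 2),
      (|p 0| + |p 1| ≤ 1 / (2 * lam) →
        lowerInf lam f K p = 2 * |p 0| - 1 / (4 * lam) - lam * ((p 0) ^ 2 + (p 1) ^ 2)) ∧
      (1 / (2 * lam) ≤ |p 0| + |p 1| →
        lowerInf lam f K p = |p 0| + 2 * lam * |p 0| * |p 1| - |p 1|) ∧
      (|p 0| + |p 1| ≤ 1 / (2 * lam) →
        upperInf lam f K p = -2 * |p 1| + 1 / (4 * lam) + lam * ((p 0) ^ 2 + (p 1) ^ 2)) ∧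
      (1 / (2 * lam) ≤ |p 0| + |p 1| →
        upperInf lam f K p = |p 0| - 2 * lam * |p 0| * |p 1| - |p 1|) ∧
      avgInf lam f K p = |p 0| - |p 1| := by
  intro p
  have hmem : ∀ q, q ∈ K ↔ q 1 = 0 ∨ q 0 = 0 := by simp [hK]
  have hmem' : ∀ q, q ∈ K ↔ q 0 = 0 ∨ q 1 = 0 := fun q => (hmem q).trans or_comm
  have hg1 : ∀ q : EuclideanSpace ℝ (Fin 2), q 0 = 0 → -f q = |q 1| := fun q hq => by
    rw [hf2 q hq, neg_neg]
  have hg2 : ∀ q : EuclideanSpace ℝ (Fin 2), q 1 = 0 → -f q = -|q 0| := fun q hq => by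
    rw [hf1 q hq]
  have hnorm : ‖p‖ ^ 2 = p 0 ^ 2 + p 1 ^ 2 := norm_sq_eq_of_ne zero_ne_one p
  have hx := sq_abs (p 0)
  have hy := sq_abs (p 1)
  have hl1 : |p 0| + |p 1| ≤ 1 / (2 * lam) →
      lowerInf lam f K p = 2 * |p 0| - 1 / (4 * lam) - lam * ((p 0) ^ 2 + (p 1) ^ 2) := by
    intro h
    rw [lowerInf, hnorm, Einf_axes_of_le zero_ne_one hmem hf1 hf2 hlam p h]
  have hl2 : 1 / (2 * lam) ≤ |p 0| + |p 1| →
      lowerInf lam f K p = |p 0| + 2 * lam * |p 0| * |p 1| - |p 1| := by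
    intro h
    rw [lowerInf, hnorm, Einf_axes_of_ge zero_ne_one hmem hf1 hf2 hlam p h]
    linear_combination lam * hx + lam * hy
  have hu1 : |p 0| + |p 1| ≤ 1 / (2 * lam) →
      upperInf lam f K p = -2 * |p 1| + 1 / (4 * lam) + lam * ((p 0) ^ 2 + (p 1) ^ 2) := by
    intro h
    rw [upperInf, hnorm,
      Einf_axes_of_le one_ne_zero hmem' hg1 hg2 hlam p (by rwa [add_comm])]
    ring
  have hu2 : 1 / (2 * lam) ≤ |p 0| + |p 1| →
      upperInf lam f K p = |p 0| - 2 * lam * |p 0| * |p 1| - |p 1| := by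
    intro h
    rw [upperInf, hnorm,
      Einf_axes_of_ge one_ne_zero hmem' hg1 hg2 hlam p (by rwa [add_comm])]
    linear_combination -lam * hx - lam * hy
  refine ⟨hl1, hl2, hu1, hu2, ?_⟩
  rw [avgInf]
  rcases le_total (|p 0| + |p 1|) (1 / (2 * lam)) with h | h
  · rw [hl1 h, hu1 h]; ring
  · rw [hl2 h, hu2 h]; ring
end

section
/- Inpainting prototype for two parallel segments (roof reconstruction): In ℝ², fix r > 0 and h > 0, let K = {(r, y) : |y| ≤ h} ∪ {(−r, y) : |y| ≤ h}, and define f : K → ℝ by f(±r, y) = 1 − |y|. Then for every λ > 1/(2h) and every (x, y) in D = co[K] = [−r, r] × [−h, h], the average approximation satisfies: A^∞_λ(f_K)(x, y) = 1 − 1/(8λ) − (λ/2) y² − |y|/2 if |y| ≤ 1/(2λ), and A^∞_λ(f_K)(x, y) = 1 − |y| if 1/(2λ) ≤ |y| ≤ h. -/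
open Metric Set

variable {E : Type*}

/-- If `a + b * q 1` is an affine minorant of `f + lam‖·‖²` on the two segments, and this function
takes the value of the minorant at `p` at the four points `(±r, ±s)`, whose convex hull contains
`p`, then the convex envelope at `p` is that value. -/
theorem Einf_eq_of_affine_minorant_s18 {r h lam a b s θ : ℝ} (hr : 0 < r)
    {f : EuclideanSpace ℝ (Fin 2) → ℝ} {p : EuclideanSpace ℝ (Fin 2)}
    (hp : |p 0| ≤ r) (hs : 0 ≤ s) (hsh : s ≤ h) (hθ : 0 ≤ θ) (hθ' : θ ≤ 1)
    (hpθ : p 1 = s * (2 * θ - 1))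
    (hminor : ∀ q : EuclideanSpace ℝ (Fin 2), (q 0 = r ∨ q 0 = -r) → |q 1| ≤ h →
      a + b * q 1 ≤ f q + lam * ‖q‖ ^ 2)
    (hval : ∀ q : EuclideanSpace ℝ (Fin 2), (q 0 = r ∨ q 0 = -r) → |q 1| = s →
      f q + lam * ‖q‖ ^ 2 = a + b * p 1) :
    Einf lam f {q : EuclideanSpace ℝ (Fin 2) | (q 0 = r ∨ q 0 = -r) ∧ |q 1| ≤ h} p =
      a + b * p 1 := by
  obtain ⟨hp1, hp2⟩ := abs_le.mp hp
  refine IsLeast.csInf_eq ⟨?_, ?_⟩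
  · have hα : 0 ≤ (r + p 0) / (2 * r) := div_nonneg (by linarith) (by linarith)
    have hβ : 0 ≤ (r - p 0) / (2 * r) := div_nonneg (by linarith) (by linarith)
    have hθ'' : 0 ≤ 1 - θ := by linarith
    have hval' : ∀ u v : ℝ, (u = r ∨ u = -r) → (v = s ∨ v = -s) →
        f !₂[u, v] + lam * ‖!₂[u, v]‖ ^ 2 = a + b * p 1 := by
      intro u v hu hv
      refine hval _ (by simpa using hu) ?_
      rcases hv with rfl | rfl <;> simp [abs_of_nonneg hs]
    refine ⟨4, ![(r + p 0) / (2 * r) * θ, (r + p 0) / (2 * r) * (1 - θ),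
      (r - p 0) / (2 * r) * θ, (r - p 0) / (2 * r) * (1 - θ)],
      ![!₂[r, s], !₂[r, -s], !₂[-r, s], !₂[-r, -s]], ?_, ?_, ?_, ?_, ?_⟩
    · intro i
      fin_cases i <;> (simp; positivity)
    · intro i
      fin_cases i <;> simp [abs_of_nonneg hs, hsh]
    · simp only [Fin.sum_univ_four, Matrix.cons_val]
      field_simp
      ring
    · ext j
      fin_cases j
      · simp [Fin.sum_univ_four]
        field_simp
        ring
      · simp [Fin.sum_univ_four, hpθ]
        field_simp
        ring
    · simp only [Fin.sum_univ_four, Matrix.cons_val]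
      rw [hval' r s (by simp) (by simp), hval' r (-s) (by simp) (by simp),
        hval' (-r) s (by simp) (by simp), hval' (-r) (-s) (by simp) (by simp)]
      field_simp
      ring
  · rintro v ⟨k, μ, q, hμ, hq, hsum, hbar, rfl⟩
    have hbar1 : ∑ i, μ i * q i 1 = p 1 := by
      simpa using congrArg (fun z : EuclideanSpace ℝ (Fin 2) => z 1) hbar
    calc a + b * p 1 = a * ∑ i, μ i + b * ∑ i, μ i * q i 1 := by rw [hsum, hbar1, mul_one]
      _ = ∑ i, μ i * (a + b * q i 1) := by
        rw [Finset.mul_sum, Finset.mul_sum, ← Finset.sum_add_distrib]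
        exact Finset.sum_congr rfl fun i _ => by ring
      _ ≤ _ := Finset.sum_le_sum fun i _ =>
        mul_le_mul_of_nonneg_left (hminor _ (hq i).1 (hq i).2) (hμ i)

theorem norm_sq_eq_of_coord_eq {r : ℝ} {q : EuclideanSpace ℝ (Fin 2)}
    (hq : q 0 = r ∨ q 0 = -r) : ‖q‖ ^ 2 = r ^ 2 + q 1 ^ 2 := by
  rw [EuclideanSpace.real_norm_sq_eq, Fin.sum_univ_two]
  rcases hq with h | h <;> simp [h]

/-- **Inpainting prototype for two parallel segments (roof reconstruction).** In `ℝ²`, with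
`K = {(±r, y) : |y| ≤ h}` and `f(±r, y) = 1 − |y|`, for every `λ > 1/(2h)` and every
`(x,y) ∈ co[K] = [−r,r] × [−h,h]`, the average approximation `A^∞_λ(f_K)` equals
`1 − 1/(8λ) − (λ/2)y² − |y|/2` if `|y| ≤ 1/(2λ)` and `1 − |y|` if `1/(2λ) ≤ |y| ≤ h`. -/
theorem inpainting_two_parallel_segments (r h : ℝ) (hr : 0 < r) (hh : 0 < h)
    (K : Set (EuclideanSpace ℝ (Fin 2)))
    (hK : K = {p : EuclideanSpace ℝ (Fin 2) | (p 0 = r ∨ p 0 = -r) ∧ |p 1| ≤ h})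
    (f : EuclideanSpace ℝ (Fin 2) → ℝ)
    (hf : ∀ p ∈ K, f p = 1 - |p 1|)
    (lam : ℝ) (hlam : 1 / (2 * h) < lam) :
    ∀ p : EuclideanSpace ℝ (Fin 2), |p 0| ≤ r → |p 1| ≤ h →
      (|p 1| ≤ 1 / (2 * lam) →
        avgInf lam f K p = 1 - 1 / (8 * lam) - lam / 2 * (p 1) ^ 2 - |p 1| / 2) ∧
      (1 / (2 * lam) ≤ |p 1| → avgInf lam f K p = 1 - |p 1|) := by
  subst hK
  intro p hp0 hp1
  have hlam0 : 0 < lam := lt_trans (by positivity) hlam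
  have hlamh : 1 / (2 * lam) < h := by
    rw [div_lt_iff₀ (by positivity)] at hlam ⊢
    linarith
  have hnorm : ‖p‖ ^ 2 = p 0 ^ 2 + p 1 ^ 2 := norm_sq_eq_of_coord_eq (Or.inl rfl)
  obtain ⟨σ, hσ, hσp⟩ : ∃ σ : ℝ, (σ = 1 ∨ σ = -1) ∧ p 1 = σ * |p 1| := by
    rcases abs_cases (p 1) with ⟨h1, -⟩ | ⟨h1, -⟩
    · exact ⟨1, by simp, by simp [h1]⟩
    · exact ⟨-1, by simp, by simp [h1]⟩
  have hσ2 : σ ^ 2 = 1 := by rcases hσ with rfl | rfl <;> norm_num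
  have hσ0 : 0 ≤ (1 + σ) / 2 := by rcases hσ with rfl | rfl <;> norm_num
  have hσ1 : (1 + σ) / 2 ≤ 1 := by rcases hσ with rfl | rfl <;> norm_num
  have hσabs : σ * p 1 = |p 1| := by linear_combination σ * hσp + |p 1| * hσ2
  have hσle : ∀ t : ℝ, σ * t ≤ |t| := by
    intro t
    rcases hσ with rfl | rfl
    · simpa using le_abs_self t
    · simpa using neg_le_abs t
  have hupper : Einf lam (fun q => -f q) _ p = _ :=
    Einf_eq_of_affine_minorant_s18 (a := -1 + lam * r ^ 2 - lam * p 1 ^ 2)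
      (b := σ * (2 * lam * |p 1| + 1)) (h := h) hr hp0 (abs_nonneg _) hp1 hσ0 hσ1
      (by linear_combination hσp)
      (by
        intro q hq hqh
        rw [hf q ⟨hq, hqh⟩, norm_sq_eq_of_coord_eq hq]
        nlinarith [hσle (q 1), mul_nonneg hlam0.le (sq_nonneg (q 1 - p 1)),
          congrArg (fun z => lam * q 1 * z) hσp])
      (by
        intro q hq hqs
        rw [hf q ⟨hq, hqs.le.trans hp1⟩, norm_sq_eq_of_coord_eq hq, ← sq_abs (q 1), hqs, sq_abs]
        linear_combination -(2 * lam * |p 1| + 1) * hσabs - 2 * lam * sq_abs (p 1))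
  have hupper_val : σ * (2 * lam * |p 1| + 1) * p 1 = 2 * lam * p 1 ^ 2 + |p 1| := by
    linear_combination (2 * lam * |p 1| + 1) * hσabs + 2 * lam * sq_abs (p 1)
  refine ⟨fun hy => ?_, fun hy => ?_⟩
  · obtain ⟨hy1, hy2⟩ := abs_le.mp hy
    have hc : lam * (1 / (2 * lam)) = 1 / 2 := by field_simp
    have hlower : Einf lam f _ p = _ :=
      Einf_eq_of_affine_minorant_s18 (a := 1 + lam * r ^ 2 - 1 / (4 * lam)) (b := 0) (h := h)
        (s := 1 / (2 * lam)) (θ := (1 + 2 * lam * p 1) / 2) hr hp0 (by positivity) hlamh.le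
        (by nlinarith) (by nlinarith) (by field_simp; ring)
        (by
          intro q hq hqh
          rw [hf q ⟨hq, hqh⟩, norm_sq_eq_of_coord_eq hq, ← sq_abs (q 1)]
          have : lam * (|q 1| - 1 / (2 * lam)) ^ 2 = lam * |q 1| ^ 2 - |q 1| + 1 / (4 * lam) := by
            field_simp
            ring
          nlinarith [mul_nonneg hlam0.le (sq_nonneg (|q 1| - 1 / (2 * lam)))])
        (by
          intro q hq hqs
          rw [hf q ⟨hq, hqs.le.trans hlamh.le⟩, norm_sq_eq_of_coord_eq hq, ← sq_abs (q 1), hqs]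
          field_simp
          ring)
    rw [avgInf, lowerInf, upperInf, hlower, hupper, hupper_val, hnorm]
    field_simp
    ring
  · have hslope : 0 ≤ 2 * lam * |p 1| - 1 := by
      rw [div_le_iff₀ (by positivity)] at hy
      linarith
    have hlower : Einf lam f _ p = _ :=
      Einf_eq_of_affine_minorant_s18 (a := 1 + lam * r ^ 2 - lam * p 1 ^ 2)
        (b := σ * (2 * lam * |p 1| - 1)) (h := h) hr hp0 (abs_nonneg _) hp1 hσ0 hσ1
        (by linear_combination hσp)
        (by
          intro q hq hqh
          rw [hf q ⟨hq, hqh⟩, norm_sq_eq_of_coord_eq hq, ← sq_abs (q 1), ← sq_abs (p 1)]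
          nlinarith [mul_le_mul_of_nonneg_left (hσle (q 1)) hslope,
            mul_nonneg hlam0.le (sq_nonneg (|q 1| - |p 1|))])
        (by
          intro q hq hqs
          rw [hf q ⟨hq, hqs.le.trans hp1⟩, norm_sq_eq_of_coord_eq hq, ← sq_abs (q 1), hqs, sq_abs]
          linear_combination -(2 * lam * |p 1| - 1) * hσabs - 2 * lam * sq_abs (p 1))
    have hlower_val : σ * (2 * lam * |p 1| - 1) * p 1 = 2 * lam * p 1 ^ 2 - |p 1| := by
      linear_combination (2 * lam * |p 1| - 1) * hσabs + 2 * lam * sq_abs (p 1)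
    rw [avgInf, lowerInf, upperInf, hlower, hupper, hlower_val, hupper_val]
    ring
end

section
/- Level-set prototype for two concentric circles: In ℝ², fix 0 < r < R and m > 0, let Γ_r and Γ_R be the circles of radii r and R centered at the origin, K = Γ_r ∪ Γ_R, and define f : K → ℝ by f = m on Γ_r and f = 0 on Γ_R. Then for every λ > m/(R² − r²) and every (x, y) with x² + y² ≤ R² (i.e., (x,y) ∈ co[K]), writing ρ = √(x² + y²), the average approximation satisfies: A^∞_λ(f_K)(x, y) = m if ρ ≤ r, and A^∞_λ(f_K)(x, y) = m (R − ρ)/(R − r) if r ≤ ρ ≤ R. -/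
open Metric Set

variable {E : Type*}

/-- The convex envelope of a function taking the value `A` on the sphere of radius `r` and the
value `B ≥ A` on the sphere of radius `R > r` (after adding `lam‖·‖²`) is the radial function that
is constant on the inner ball and affine in the radius outside. -/
theorem Einf_two_spheres [NormedAddCommGroup E] [NormedSpace ℝ E] [Nontrivial E]
    {r R lam A B : ℝ} (hr : 0 < r) (hrR : r < R) (hAB : A ≤ B) {f : E → ℝ}
    (hA : ∀ p, ‖p‖ = r → f p + lam * ‖p‖ ^ 2 = A)
    (hB : ∀ p, ‖p‖ = R → f p + lam * ‖p‖ ^ 2 = B) {x : E} (hx : ‖x‖ ≤ R) :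
    Einf lam f ({p | ‖p‖ = r} ∪ {p | ‖p‖ = R}) x
      = A + (B - A) / (R - r) * max (‖x‖ - r) 0 := by
  have hd : 0 < R - r := sub_pos.2 hrR
  have hs : 0 ≤ (B - A) / (R - r) := div_nonneg (sub_nonneg.2 hAB) hd.le
  refine IsLeast.csInf_eq ⟨?_, ?_⟩
  · obtain ⟨u, hu, hxu⟩ : ∃ u : E, ‖u‖ = 1 ∧ x = ‖x‖ • u := by
      by_cases h0 : x = 0
      · obtain ⟨u, hu⟩ := exists_norm_eq E zero_le_one
        exact ⟨u, hu, by simp [h0]⟩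
      · have hn : ‖x‖ ≠ 0 := norm_ne_zero_iff.2 h0
        exact ⟨‖x‖⁻¹ • x, by simp [norm_smul, hn], by rw [smul_smul, mul_inv_cancel₀ hn, one_smul]⟩
    have hnorm (c : ℝ) : ‖c • u‖ = |c| := by rw [norm_smul, hu, mul_one, Real.norm_eq_abs]
    have hru : ‖r • u‖ = r := by rw [hnorm, abs_of_pos hr]
    have hnru : ‖(-r) • u‖ = r := by rw [hnorm, abs_neg, abs_of_pos hr]
    have hRu : ‖R • u‖ = R := by rw [hnorm, abs_of_pos (hr.trans hrR)]
    rcases le_total ‖x‖ r with h | h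
    · refine ⟨2, ![(r + ‖x‖) / (2 * r), (r - ‖x‖) / (2 * r)], ![r • u, (-r) • u],
        ?_, ?_, ?_, ?_, ?_⟩
      · simp only [Fin.forall_fin_two, Matrix.cons_val_zero, Matrix.cons_val_one]
        exact ⟨by positivity, div_nonneg (sub_nonneg.2 h) (by positivity)⟩
      · simp only [Fin.forall_fin_two, Matrix.cons_val_zero, Matrix.cons_val_one]
        exact ⟨Or.inl hru, Or.inl hnru⟩
      · simp only [Fin.sum_univ_two, Matrix.cons_val_zero, Matrix.cons_val_one]
        field_simp
        ring
      · simp only [Fin.sum_univ_two, Matrix.cons_val_zero, Matrix.cons_val_one]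
        rw [smul_smul, smul_smul, ← add_smul]
        conv_rhs => rw [hxu]
        congr 1
        field_simp
        ring
      · simp only [Fin.sum_univ_two, Matrix.cons_val_zero, Matrix.cons_val_one]
        rw [hA _ hru, hA _ hnru, max_eq_right (sub_nonpos.2 h)]
        field_simp
        ring
    · refine ⟨2, ![(R - ‖x‖) / (R - r), (‖x‖ - r) / (R - r)], ![r • u, R • u],
        ?_, ?_, ?_, ?_, ?_⟩
      · simp only [Fin.forall_fin_two, Matrix.cons_val_zero, Matrix.cons_val_one]
        exact ⟨div_nonneg (sub_nonneg.2 hx) hd.le, div_nonneg (sub_nonneg.2 h) hd.le⟩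
      · simp only [Fin.forall_fin_two, Matrix.cons_val_zero, Matrix.cons_val_one]
        exact ⟨Or.inl hru, Or.inr hRu⟩
      · simp only [Fin.sum_univ_two, Matrix.cons_val_zero, Matrix.cons_val_one]
        field_simp
        ring
      · simp only [Fin.sum_univ_two, Matrix.cons_val_zero, Matrix.cons_val_one]
        rw [smul_smul, smul_smul, ← add_smul]
        conv_rhs => rw [hxu]
        congr 1
        field_simp
        ring
      · simp only [Fin.sum_univ_two, Matrix.cons_val_zero, Matrix.cons_val_one]
        rw [hA _ hru, hB _ hRu, max_eq_left (sub_nonneg.2 h)]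
        field_simp
        ring
  · rintro v ⟨k, μ, p, hμ, hp, hsum, hbar, rfl⟩
    have hval (i) : f (p i) + lam * ‖p i‖ ^ 2 = A + (B - A) / (R - r) * (‖p i‖ - r) := by
      rcases hp i with h | h
      · rw [hA _ h, h, sub_self, mul_zero, add_zero]
      · rw [hB _ h, h, div_mul_cancel₀ _ hd.ne']
        ring
    have hrp (i) : r ≤ ‖p i‖ := (hp i).elim ge_of_eq fun h => hrR.le.trans (ge_of_eq h)
    have hsum_eq : ∑ i, μ i * (f (p i) + lam * ‖p i‖ ^ 2)
        = A + (B - A) / (R - r) * (∑ i, μ i * ‖p i‖ - r) := by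
      calc _ = ∑ i, ((A - (B - A) / (R - r) * r) * μ i
              + (B - A) / (R - r) * (μ i * ‖p i‖)) :=
            Finset.sum_congr rfl fun i _ => by rw [hval]; ring
        _ = _ := by
            rw [Finset.sum_add_distrib, ← Finset.mul_sum, ← Finset.mul_sum, hsum]
            ring
    have hnorm_le : ‖x‖ ≤ ∑ i, μ i * ‖p i‖ := by
      rw [← hbar]
      exact (norm_sum_le _ _).trans_eq <| Finset.sum_congr rfl fun i _ => by
        rw [norm_smul, Real.norm_of_nonneg (hμ i)]
    have hr_le : r ≤ ∑ i, μ i * ‖p i‖ := by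
      calc r = ∑ i, μ i * r := by rw [← Finset.sum_mul, hsum, one_mul]
        _ ≤ _ := Finset.sum_le_sum fun i _ => mul_le_mul_of_nonneg_left (hrp i) (hμ i)
    rw [hsum_eq]
    gcongr
    exact max_le (by linarith) (by linarith)

/-- **Level-set prototype for two concentric circles.** In `ℝ²`, with `0 < r < R`, `m > 0`,
`K = Γ_r ∪ Γ_R` the union of the circles of radii `r` and `R` centered at the origin, and
`f = m` on `Γ_r`, `f = 0` on `Γ_R`, for every `λ > m/(R² − r²)` and every point `p` with
`‖p‖ ≤ R` (i.e. `p ∈ co[K]`), the average approximation satisfies `A^∞_λ(f_K)(p) = m` if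
`‖p‖ ≤ r`, and `A^∞_λ(f_K)(p) = m(R − ‖p‖)/(R − r)` if `r ≤ ‖p‖ ≤ R`. -/
theorem level_set_two_concentric_circles (r R m : ℝ) (hr : 0 < r) (hrR : r < R) (hm : 0 < m)
    (K : Set (EuclideanSpace ℝ (Fin 2)))
    (hK : K = {p : EuclideanSpace ℝ (Fin 2) | ‖p‖ = r} ∪
      {p : EuclideanSpace ℝ (Fin 2) | ‖p‖ = R})
    (f : EuclideanSpace ℝ (Fin 2) → ℝ)
    (hf1 : ∀ p : EuclideanSpace ℝ (Fin 2), ‖p‖ = r → f p = m)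
    (hf2 : ∀ p : EuclideanSpace ℝ (Fin 2), ‖p‖ = R → f p = 0)
    (lam : ℝ) (hlam : m / (R ^ 2 - r ^ 2) < lam) :
    ∀ p : EuclideanSpace ℝ (Fin 2), ‖p‖ ≤ R →
      (‖p‖ ≤ r → avgInf lam f K p = m) ∧
      (r ≤ ‖p‖ → avgInf lam f K p = m * (R - ‖p‖) / (R - r)) := by
  have hd : 0 < R - r := sub_pos.2 hrR
  have hlam' : m < lam * (R ^ 2 - r ^ 2) := by
    refine (div_lt_iff₀ ?_).1 hlam
    nlinarith
  intro p hp
  have hlow := Einf_two_spheres (lam := lam) (A := m + lam * r ^ 2) (B := lam * R ^ 2) hr hrR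
    (by linarith) (f := f) (fun q hq => by rw [hf1 q hq, hq])
    (fun q hq => by rw [hf2 q hq, hq, zero_add]) hp
  have hupp := Einf_two_spheres (lam := lam) (A := -m + lam * r ^ 2) (B := lam * R ^ 2) hr hrR
    (by linarith) (f := fun y => -f y) (fun q hq => by rw [hf1 q hq, hq])
    (fun q hq => by rw [hf2 q hq, hq, neg_zero, zero_add]) hp
  rw [← hK] at hlow hupp
  unfold avgInf lowerInf upperInf
  rw [hlow, hupp]
  refine ⟨fun h => ?_, fun h => ?_⟩
  · rw [max_eq_right (sub_nonpos.2 h)]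
    ring
  · rw [max_eq_left (sub_nonneg.2 h)]
    field_simp
    ring
end
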